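/- arXiv:1510.07706 — 10 statements merged into one kernel-verified Lean document; each statement's English description precedes it below -/
import Mathlib

section
/- Let λ be a nonzero real number. Suppose ũ, ṽ : ℝ → ℝ are differentiable functions satisfying ((λ+λ⁻¹)/2)·ũ'(s) = ((λ−λ⁻¹)/2)·(ũ(s)² − ṽ(s)² − 1/4) − 2·ũ(s)·ṽ(s) and ((λ+λ⁻¹)/2)·ṽ'(s) = −(λ−λ⁻¹)·ũ(s)·ṽ(s) − (ũ(s)² − ṽ(s)² − 1/4) for all s ∈ ℝ, and suppose ũ(s) → −1/2 and ṽ(s) → 0 as s → −∞. Then for every s ∈ ℝ, (1/3)·ũ(s)³ − ũ(s)·ṽ(s)² − (1/4)·ũ(s) − ((λ−λ⁻¹)/2)·(ṽ(s)³ − ũ(s)²·ṽ(s) + (1/4)·ṽ(s)) = 1/12. -/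
open Filter

/-- A globally defined function with `D ^ 4 ≤ (M * D') ^ 3`, i.e. `D' ≥ D ^ (4 / 3) / M`, is
nowhere positive: a positive value would force blow-up in finite time. -/
theorem nonpos_of_pow_four_le_deriv_pow_three {D D' : ℝ → ℝ} {M : ℝ} (hM : 0 < M)
    (hD : ∀ s, HasDerivAt D (D' s) s) (hle : ∀ s, D s ^ 4 ≤ (M * D' s) ^ 3) (t : ℝ) :
    D t ≤ 0 := by
  by_contra! ht
  have hD' : ∀ s, 0 ≤ D' s := fun s => by
    have h : 0 ≤ (M * D' s) ^ 3 := (by positivity : 0 ≤ D s ^ 4).trans (hle s)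
    exact nonneg_of_mul_nonneg_right ((Odd.pow_nonneg_iff (by decide)).1 h) hM
  have hmono : Monotone D := monotone_of_hasDerivAt_nonneg hD hD'
  have hpos : ∀ s ∈ Set.Ici t, 0 < D s := fun s hs => ht.trans_le (hmono hs)
  have hder : ∀ s ∈ Set.Ici t, HasDerivAt (fun x => D x ^ (-(1 / 3) : ℝ) + x / (3 * M))
      (D' s * (-(1 / 3)) * D s ^ (-(1 / 3) - 1 : ℝ) + 1 / (3 * M)) s := fun s hs =>
    ((hD s).rpow_const (Or.inl (hpos s hs).ne')).add ((hasDerivAt_id s).div_const _)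
  have hanti : AntitoneOn (fun x => D x ^ (-(1 / 3) : ℝ) + x / (3 * M)) (Set.Ici t) := by
    refine antitoneOn_of_deriv_nonpos (convex_Ici t)
      (fun s hs => (hder s hs).continuousAt.continuousWithinAt)
      (fun s hs => (hder s (interior_subset hs)).differentiableAt.differentiableWithinAt)
      fun s hs => ?_
    have hs := interior_subset hs
    rw [(hder s hs).deriv]
    have hp := hpos s hs
    have hroot : D s ^ (4 / 3 : ℝ) ≤ M * D' s := by
      refine le_of_pow_le_pow_left₀ (n := 3) (by norm_num) (mul_nonneg hM.le (hD' s)) ?_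
      rw [← Real.rpow_natCast, ← Real.rpow_mul hp.le]
      refine le_trans (le_of_eq ?_) (hle s)
      rw [← Real.rpow_natCast]
      norm_num
    have hinv : D s ^ (-(1 / 3) - 1 : ℝ) = (D s ^ (4 / 3 : ℝ))⁻¹ := by
      rw [← Real.rpow_neg hp.le]
      norm_num
    have hq : 0 < D s ^ (4 / 3 : ℝ) := Real.rpow_pos_of_pos hp _
    have hge : 1 / M ≤ D' s * (D s ^ (4 / 3 : ℝ))⁻¹ := by
      rw [← div_eq_mul_inv, div_le_div_iff₀ hM hq]
      linarith
    have hsplit : 1 / (3 * M) = 1 / 3 * (1 / M) := by ring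
    rw [hinv, hsplit]
    linarith
  set C := D t ^ (-(1 / 3) : ℝ) + t / (3 * M) with hC
  have hmem : t ≤ max t (3 * M * C) := le_max_left _ _
  have hbound := hanti (Set.mem_Ici.2 le_rfl) (Set.mem_Ici.2 hmem) hmem
  have hlarge : C ≤ max t (3 * M * C) / (3 * M) := by
    rw [le_div_iff₀ (by positivity)]
    linarith [le_max_right t (3 * M * C)]
  have hposs := Real.rpow_pos_of_pos (hpos _ hmem) (-(1 / 3))
  simp only [← hC] at hbound
  linarith

/-- A function with vanishing derivative equals its limit at `-∞`. -/
theorem eq_of_hasDerivAt_zero_of_tendsto_atBot {F : ℝ → ℝ} {a : ℝ}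
    (hF : ∀ s, HasDerivAt F 0 s) (hlim : Tendsto F atBot (nhds a)) (s : ℝ) : F s = a := by
  have hconst : F = fun _ => F s := funext fun x =>
    is_const_of_deriv_eq_zero (fun y => (hF y).differentiableAt) (fun y => (hF y).deriv) x s
  rw [hconst] at hlim
  exact tendsto_nhds_unique tendsto_const_nhds hlim

/-- The level set of the first integral through `(-1/2, 0)` stays away from the other
equilibrium `(1/2, 0)`. -/
theorem exists_pos_le_dist_sq_of_level (k : ℝ) :
    ∃ d : ℝ, 0 < d ∧ ∀ x y : ℝ,
      x ^ 3 / 3 - x * y ^ 2 - x / 4 + k * (x ^ 2 * y - y ^ 3 / 3 - y / 4) = 1 / 12 →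
        d ≤ (x - 1 / 2) ^ 2 + y ^ 2 := by
  have hcont : Continuous fun p : ℝ × ℝ => p.1 ^ 3 / 3 - p.1 * p.2 ^ 2 - p.1 / 4
      + k * (p.1 ^ 2 * p.2 - p.2 ^ 3 / 3 - p.2 / 4) := by fun_prop
  have hopen := isOpen_lt hcont (continuous_const (y := (1 / 12 : ℝ)))
  obtain ⟨δ, hδ, hball⟩ := Metric.isOpen_iff.1 hopen (1 / 2, 0) (by
    simp only [Set.mem_ofPred_eq]
    norm_num)
  refine ⟨δ ^ 2, by positivity, fun x y hxy => ?_⟩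
  by_contra! hlt
  have hx : |x - 1 / 2| < δ := abs_lt_of_sq_lt_sq (by nlinarith [sq_nonneg y]) hδ.le
  have hy : |y - 0| < δ := abs_lt_of_sq_lt_sq (by nlinarith [sq_nonneg (x - 1 / 2)]) hδ.le
  have hmem : (x, y) ∈ Metric.ball ((1 / 2, 0) : ℝ × ℝ) δ := by
    rw [Metric.mem_ball, Prod.dist_eq]
    exact max_lt hx hy
  exact absurd hxy (ne_of_lt (hball hmem))

/-- A global solution emanating from `(-1/2, 0)` lies on the corresponding level of the first
integral and has `v = 0`: otherwise it would blow up in finite time. With `z = u + i v` the system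
is `c z' = (k - i) * conj (z ^ 2 - 1 / 4)`, a gradient flow for the real part of a multiple of
`z ^ 3 / 3 - z / 4`, whose imaginary part is conserved. -/
theorem eq_zero_of_tendsto_atBot {k c : ℝ} (hck : c ^ 2 = k ^ 2 + 1) {u v u' v' : ℝ → ℝ}
    (hu : ∀ s, HasDerivAt u (u' s) s) (hv : ∀ s, HasDerivAt v (v' s) s)
    (h1 : ∀ s, c * u' s = k * (u s ^ 2 - v s ^ 2 - 1 / 4) - 2 * u s * v s)
    (h2 : ∀ s, c * v' s = -(2 * k) * (u s * v s) - (u s ^ 2 - v s ^ 2 - 1 / 4))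
    (hulim : Tendsto u atBot (nhds (-(1 / 2)))) (hvlim : Tendsto v atBot (nhds 0)) (s : ℝ) :
    u s ^ 3 / 3 - u s * v s ^ 2 - u s / 4
      + k * (u s ^ 2 * v s - v s ^ 3 / 3 - v s / 4) = 1 / 12 ∧ v s = 0 := by
  have hc : c ≠ 0 := by
    rintro rfl
    nlinarith [sq_nonneg k]
  have hre : ∀ s, HasDerivAt (fun x => u x ^ 3 / 3 - u x * v x ^ 2 - u x / 4)
      ((u s ^ 2 - v s ^ 2 - 1 / 4) * u' s - 2 * u s * v s * v' s) s := fun s => by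
    have h := ((((hu s).pow 3).div_const 3).sub ((hu s).mul ((hv s).pow 2))).sub
      ((hu s).div_const 4)
    refine h.congr_deriv ?_
    simp
    ring
  have him : ∀ s, HasDerivAt (fun x => u x ^ 2 * v x - v x ^ 3 / 3 - v x / 4)
      (2 * u s * v s * u' s + (u s ^ 2 - v s ^ 2 - 1 / 4) * v' s) s := fun s => by
    have h := ((((hu s).pow 2).mul (hv s)).sub (((hv s).pow 3).div_const 3)).sub
      ((hv s).div_const 4)
    refine h.congr_deriv ?_
    simp
    ring
  have hrelim : Tendsto (fun x => u x ^ 3 / 3 - u x * v x ^ 2 - u x / 4) atBot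
      (nhds (1 / 12)) := by
    have h := (((hulim.pow 3).div_const 3).sub (hulim.mul (hvlim.pow 2))).sub
      (hulim.div_const 4)
    convert h using 2
    norm_num
  have himlim : Tendsto (fun x => u x ^ 2 * v x - v x ^ 3 / 3 - v x / 4) atBot (nhds 0) := by
    have h := (((hulim.pow 2).mul hvlim).sub ((hvlim.pow 3).div_const 3)).sub
      (hvlim.div_const 4)
    convert h using 2
    norm_num
  have hlevel : ∀ s, u s ^ 3 / 3 - u s * v s ^ 2 - u s / 4
      + k * (u s ^ 2 * v s - v s ^ 3 / 3 - v s / 4) = 1 / 12 := by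
    refine eq_of_hasDerivAt_zero_of_tendsto_atBot
      (fun s => ((hre s).add ((him s).const_mul k)).congr_deriv ?_) ?_
    · refine mul_left_cancel₀ hc ?_
      linear_combination ((u s ^ 2 - v s ^ 2 - 1 / 4) + k * (2 * u s * v s)) * h1 s
        + (k * (u s ^ 2 - v s ^ 2 - 1 / 4) - 2 * u s * v s) * h2 s
    · simpa using hrelim.add (himlim.const_mul k)
  refine ⟨hlevel s, ?_⟩
  set D : ℝ → ℝ := fun x => (k * (u x ^ 3 / 3 - u x * v x ^ 2 - u x / 4)
    - (u x ^ 2 * v x - v x ^ 3 / 3 - v x / 4) - k / 12) / c with hDdef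
  have hD : ∀ s, HasDerivAt D
      (((u s + 1 / 2) ^ 2 + v s ^ 2) * ((u s - 1 / 2) ^ 2 + v s ^ 2)) s := fun s => by
    refine (((((hre s).const_mul k).sub (him s)).sub_const (k / 12)).div_const c).congr_deriv ?_
    rw [div_eq_iff hc]
    refine mul_left_cancel₀ hc ?_
    linear_combination (k * (u s ^ 2 - v s ^ 2 - 1 / 4) - 2 * u s * v s) * h1 s
      + (-(2 * k) * (u s * v s) - (u s ^ 2 - v s ^ 2 - 1 / 4)) * h2 s
      - ((u s + 1 / 2) ^ 2 + v s ^ 2) * ((u s - 1 / 2) ^ 2 + v s ^ 2) * hck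
  have hDlim : Tendsto D atBot (nhds 0) := by
    have h := (((hrelim.const_mul k).sub himlim).sub_const (k / 12)).div_const c
    convert h using 2
    ring
  have hDsq : ∀ s, 9 * D s ^ 2 = ((u s + 1 / 2) ^ 2 + v s ^ 2) ^ 2 * ((u s - 1) ^ 2 + v s ^ 2) :=
    fun s => by
      have hcD : c * D s = k * (u s ^ 3 / 3 - u s * v s ^ 2 - u s / 4)
          - (u s ^ 2 * v s - v s ^ 3 / 3 - v s / 4) - k / 12 := mul_div_cancel₀ _ hc
      have hlev := hlevel s
      have hnorm : D s ^ 2 = (u s ^ 3 / 3 - u s * v s ^ 2 - u s / 4 - 1 / 12) ^ 2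
          + (u s ^ 2 * v s - v s ^ 3 / 3 - v s / 4) ^ 2 := by
        generalize u s ^ 3 / 3 - u s * v s ^ 2 - u s / 4 = X at *
        generalize u s ^ 2 * v s - v s ^ 3 / 3 - v s / 4 = Y at *
        refine mul_left_cancel₀ (pow_ne_zero 2 hc) ?_
        linear_combination (c * D s + (k * X - Y - k / 12)) * hcD
          - (X + k * Y - 1 / 12) * hlev - ((X - 1 / 12) ^ 2 + Y ^ 2) * hck
      rw [hnorm]
      ring
  have hmono : Monotone D := monotone_of_hasDerivAt_nonneg hD fun s => by
    simp only [Pi.zero_apply]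
    positivity
  have hDnonneg : 0 ≤ D s := hmono.le_of_tendsto hDlim s
  obtain ⟨d, hd, hdist⟩ := exists_pos_le_dist_sq_of_level k
  have hDnonpos : D s ≤ 0 := by
    refine nonpos_of_pow_four_le_deriv_pow_three (M := 2 + 2 / d) (by positivity) hD
      (fun s => ?_) s
    have hq := hdist _ _ (hlevel s)
    have hsq := hDsq s
    have hfar : 2 ≤ 2 / d * ((u s - 1 / 2) ^ 2 + v s ^ 2) := by
      rw [div_mul_eq_mul_div, le_div_iff₀ hd]
      linarith
    have ha : (u s + 1 / 2) ^ 2 + v s ^ 2 ≤ (2 + 2 / d) * ((u s - 1 / 2) ^ 2 + v s ^ 2) := by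
      nlinarith [sq_nonneg (u s - 3 / 2), sq_nonneg (v s)]
    have he : (u s - 1) ^ 2 + v s ^ 2 ≤ (2 + 2 / d) * ((u s - 1 / 2) ^ 2 + v s ^ 2) := by
      nlinarith [sq_nonneg (u s), sq_nonneg (v s)]
    have ha0 : 0 ≤ (u s + 1 / 2) ^ 2 + v s ^ 2 := by positivity
    have he0 : 0 ≤ (u s - 1) ^ 2 + v s ^ 2 := by positivity
    generalize (u s + 1 / 2) ^ 2 + v s ^ 2 = a at *
    generalize (u s - 1) ^ 2 + v s ^ 2 = e at *
    generalize (u s - 1 / 2) ^ 2 + v s ^ 2 = q at *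
    have hMq : 0 ≤ (2 + 2 / d) * q := ha0.trans ha
    calc D s ^ 4 ≤ (9 * D s ^ 2) ^ 2 := by nlinarith [sq_nonneg (D s ^ 2)]
      _ = a ^ 3 * (a * e ^ 2) := by rw [hsq]; ring
      _ ≤ a ^ 3 * (((2 + 2 / d) * q) * ((2 + 2 / d) * q) ^ 2) := by gcongr
      _ = ((2 + 2 / d) * (a * q)) ^ 3 := by ring
  have hzero := hDsq s
  rw [le_antisymm hDnonpos hDnonneg] at hzero
  have hprod : ((u s + 1 / 2) ^ 2 + v s ^ 2) ^ 2 * ((u s - 1) ^ 2 + v s ^ 2) = 0 := by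
    linarith
  rcases mul_eq_zero.1 hprod with h | h
  · exact pow_eq_zero_iff two_ne_zero |>.1
      (by nlinarith [pow_eq_zero_iff two_ne_zero |>.1 h, sq_nonneg (u s + 1 / 2), sq_nonneg (v s)])
  · exact pow_eq_zero_iff two_ne_zero |>.1 (by nlinarith [sq_nonneg (u s - 1), sq_nonneg (v s)])

/-- With the limit conditions `ũ → −1/2`, `ṽ → 0` as `s → −∞`, the first integral
takes the value `1/12` along the solution. -/
theorem stmt_1 (l : ℝ) (hl : l ≠ 0) (u v : ℝ → ℝ)
    (hu : Differentiable ℝ u) (hv : Differentiable ℝ v)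
    (h1 : ∀ s : ℝ, ((l + l⁻¹) / 2) * deriv u s =
      ((l - l⁻¹) / 2) * (u s ^ 2 - v s ^ 2 - 1 / 4) - 2 * u s * v s)
    (h2 : ∀ s : ℝ, ((l + l⁻¹) / 2) * deriv v s =
      -(l - l⁻¹) * (u s * v s) - (u s ^ 2 - v s ^ 2 - 1 / 4))
    (hulim : Tendsto u atBot (nhds (-(1 / 2))))
    (hvlim : Tendsto v atBot (nhds 0)) :
    ∀ s : ℝ,
      (1 / 3) * u s ^ 3 - u s * v s ^ 2 - (1 / 4) * u s
        - ((l - l⁻¹) / 2) * (v s ^ 3 - u s ^ 2 * v s + (1 / 4) * v s) = 1 / 12 := by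
  intro s
  obtain ⟨hlevel, hvs⟩ := eq_zero_of_tendsto_atBot (k := (l - l⁻¹) / 2) (c := (l + l⁻¹) / 2)
    (by field_simp; ring) (fun s => (hu s).hasDerivAt) (fun s => (hv s).hasDerivAt) h1
    (fun s => by rw [h2 s]; ring) hulim hvlim s
  rw [hvs] at hlevel ⊢
  linarith
end

section
/- Let λ be a real number with λ ∉ {0, 1, −1}, and let M ≥ 0 and c be real numbers. Then there exists M' ≥ 0 such that for all real numbers u, v with |u| ≤ M and (1/3)·u³ − u·v² − (1/4)·u − ((λ−λ⁻¹)/2)·(v³ − u²·v + (1/4)·v) = c, one has |v| ≤ M'. -/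
/-- An elementary Cauchy-type bound for the nonnegative solutions of a cubic inequality. -/
theorem le_of_cubic_le {a A B C x : ℝ} (ha : 0 < a) (hA : 0 ≤ A) (hB : 0 ≤ B) (hC : 0 ≤ C)
    (h : a * x ^ 3 ≤ A * x ^ 2 + B * x + C) : x ≤ 1 + (A + B + C) / a := by
  by_contra! hx
  have hS : 0 ≤ (A + B + C) / a := by positivity
  have hx1 : 1 < x := by linarith
  have hlt : A + B + C < a * x := by
    rw [mul_comm]
    exact (div_lt_iff₀ ha).1 (by linarith)
  have hBx : B * x ≤ B * x ^ 2 := mul_le_mul_of_nonneg_left (by nlinarith) hB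
  have hCx : C ≤ C * x ^ 2 := le_mul_of_one_le_right hC (by nlinarith)
  have hmul : (A + B + C) * x ^ 2 < a * x * x ^ 2 :=
    mul_lt_mul_of_pos_right hlt (by positivity)
  linarith [show a * x * x ^ 2 = a * x ^ 3 by ring]

theorem sub_inv_ne_zero_of_ne_one_of_ne_neg_one {K : Type*} [Field K] {x : K} (h0 : x ≠ 0)
    (h1 : x ≠ 1) (h2 : x ≠ -1) : x - x⁻¹ ≠ 0 := by
  intro h
  have hx : x * x = 1 := by
    rw [← mul_inv_cancel₀ h0, ← sub_eq_zero.1 h]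
  exact (mul_self_eq_one_iff.1 hx).elim h1 h2

/-- Level-set boundedness: for `λ ∉ {0, 1, −1}`, on each level set of the first
integral, bounded `u` forces bounded `v`. -/
theorem stmt_2 (l : ℝ) (hl0 : l ≠ 0) (hl1 : l ≠ 1) (hl2 : l ≠ -1)
    (M : ℝ) (hM : 0 ≤ M) (c : ℝ) :
    ∃ M' : ℝ, 0 ≤ M' ∧ ∀ u v : ℝ, |u| ≤ M →
      (1 / 3) * u ^ 3 - u * v ^ 2 - (1 / 4) * u
        - ((l - l⁻¹) / 2) * (v ^ 3 - u ^ 2 * v + (1 / 4) * v) = c →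
      |v| ≤ M' := by
  have hk : 0 < |(l - l⁻¹) / 2| :=
    abs_pos.2 (div_ne_zero (sub_inv_ne_zero_of_ne_one_of_ne_neg_one hl0 hl1 hl2) two_ne_zero)
  set k := (l - l⁻¹) / 2
  refine ⟨1 + (M + |k| * (M ^ 2 + 1 / 4) + (M ^ 3 / 3 + M / 4 + |c|)) / |k|, by positivity,
    fun u v hu h ↦ ?_⟩
  refine le_of_cubic_le hk hM (by positivity) (by positivity) ?_
  have hcubic : k * v ^ 3 = -u * v ^ 2 + k * (u ^ 2 - 1 / 4) * v + (u ^ 3 / 3 - u / 4 - c) := by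
    linarith
  have hquad : |u ^ 2 - 1 / 4| ≤ M ^ 2 + 1 / 4 := by
    have : |u| ^ 2 ≤ M ^ 2 := by gcongr
    rw [sq_abs] at this
    exact abs_le.2 ⟨by nlinarith, by linarith⟩
  have hconst : |u ^ 3 / 3 - u / 4 - c| ≤ M ^ 3 / 3 + M / 4 + |c| := calc
    |u ^ 3 / 3 - u / 4 - c| ≤ |u ^ 3 / 3| + |u / 4| + |c| :=
      (abs_sub _ _).trans (by gcongr; exact abs_sub _ _)
    _ = |u| ^ 3 / 3 + |u| / 4 + |c| := by simp [abs_div]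
    _ ≤ M ^ 3 / 3 + M / 4 + |c| := by gcongr
  calc |k| * |v| ^ 3
      = |-u * v ^ 2 + k * (u ^ 2 - 1 / 4) * v + (u ^ 3 / 3 - u / 4 - c)| := by
        rw [← hcubic, abs_mul, abs_pow]
    _ ≤ |-u * v ^ 2| + |k * (u ^ 2 - 1 / 4) * v| + |u ^ 3 / 3 - u / 4 - c| := abs_add_three _ _ _
    _ = |u| * |v| ^ 2 + |k| * |u ^ 2 - 1 / 4| * |v| + |u ^ 3 / 3 - u / 4 - c| := by
        simp only [abs_mul, abs_neg, abs_pow]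
    _ ≤ M * |v| ^ 2 + |k| * (M ^ 2 + 1 / 4) * |v| + (M ^ 3 / 3 + M / 4 + |c|) := by
        gcongr
end

section
/- Let C be a real number. Define f(t) = 3C/(C²t² + 4Ct + 1) and g(t) = 3C(Ct+1)/((C²t² + 4Ct + 1)(Ct − 1)). Then for every t ≥ 0 such that C²t² + 4Ct + 1 ≠ 0 and Ct ≠ 1, the functions f and g satisfy t·f'(t) + f(t) + g(t) − 2·f(t)·g(t)·t = 0 and t·g'(t) + g(t) + f(t) − t·(f(t)² − g(t)²) = 0. -/
/-- The explicit family `f(t) = 3C/(C²t²+4Ct+1)`,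
`g(t) = 3C(Ct+1)/((C²t²+4Ct+1)(Ct−1))` solves the Kapustin–Witten ODEs. -/
theorem stmt_5 (C : ℝ) :
    let f : ℝ → ℝ := fun t => 3 * C / (C ^ 2 * t ^ 2 + 4 * C * t + 1)
    let g : ℝ → ℝ := fun t =>
      3 * C * (C * t + 1) / ((C ^ 2 * t ^ 2 + 4 * C * t + 1) * (C * t - 1))
    ∀ t : ℝ, 0 ≤ t → C ^ 2 * t ^ 2 + 4 * C * t + 1 ≠ 0 → C * t ≠ 1 →
      (t * deriv f t + f t + g t - 2 * f t * g t * t = 0) ∧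
      (t * deriv g t + g t + f t - t * (f t ^ 2 - g t ^ 2) = 0) := by
  intro f g t _ hD hCt
  have hE : C * t - 1 ≠ 0 := sub_ne_zero.mpr hCt
  have hlin (a : ℝ) : HasDerivAt (fun s : ℝ => C * s + a) C t := by
    simpa using ((hasDerivAt_id t).const_mul C).add_const a
  have hden : HasDerivAt (fun s : ℝ => C ^ 2 * s ^ 2 + 4 * C * s + 1)
      (2 * C ^ 2 * t + 4 * C) t := by
    refine HasDerivAt.congr_deriv ((((hasDerivAt_pow 2 t).const_mul (C ^ 2)).add
      ((hasDerivAt_id t).const_mul (4 * C))).add_const 1) ?_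
    norm_num
    ring
  have hf : deriv f t = _ := ((hasDerivAt_const t (3 * C)).div hden hD).deriv
  have hg : deriv g t = _ :=
    (((hlin 1).const_mul (3 * C)).div (hden.mul (hlin (-1))) (mul_ne_zero hD hE)).deriv
  rw [hf, hg]
  simp only [f, g, Pi.mul_apply, ← sub_eq_add_neg]
  generalize hDeq : C ^ 2 * t ^ 2 + 4 * C * t + 1 = D at hD ⊢
  generalize hEeq : C * t - 1 = E at hE ⊢
  constructor
  · field_simp
    subst hDeq hEeq
    ring
  · field_simp
    subst hDeq hEeq
    ring
end

section
/- Let C be a real number. Define f(t) = (1/t)·(C²t² + Ct + 1)/(C²t² + 4Ct + 1) and g(t) = 3C(Ct+1)/((C²t² + 4Ct + 1)(Ct − 1)). Then for every t > 0 such that C²t² + 4Ct + 1 ≠ 0 and Ct ≠ 1, the functions f and g satisfy t·f'(t) + f(t) + g(t) − 2·f(t)·g(t)·t = 0 and t·g'(t) + g(t) + f(t) − t·(f(t)² − g(t)²) = 0. -/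
/-- The explicit family `f(t) = (1/t)·(C²t²+Ct+1)/(C²t²+4Ct+1)`,
`g(t) = 3C(Ct+1)/((C²t²+4Ct+1)(Ct−1))` solves the Kapustin–Witten ODEs. -/
theorem stmt_6 (C : ℝ) :
    let f : ℝ → ℝ := fun t =>
      (1 / t) * ((C ^ 2 * t ^ 2 + C * t + 1) / (C ^ 2 * t ^ 2 + 4 * C * t + 1))
    let g : ℝ → ℝ := fun t =>
      3 * C * (C * t + 1) / ((C ^ 2 * t ^ 2 + 4 * C * t + 1) * (C * t - 1))
    ∀ t : ℝ, 0 < t → C ^ 2 * t ^ 2 + 4 * C * t + 1 ≠ 0 → C * t ≠ 1 →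
      (t * deriv f t + f t + g t - 2 * f t * g t * t = 0) ∧
      (t * deriv g t + g t + f t - t * (f t ^ 2 - g t ^ 2) = 0) := by
  intro f g t ht hQ hs
  have ht0 : t ≠ 0 := ht.ne'
  have hs' : C * t - 1 ≠ 0 := sub_ne_zero.mpr hs
  have hlin : HasDerivAt (fun x : ℝ => C * x) C t := by
    simpa using (hasDerivAt_id t).const_mul C
  have hquad (a : ℝ) :
      HasDerivAt (fun x : ℝ => C ^ 2 * x ^ 2 + a * x + 1) (2 * C ^ 2 * t + a) t := by
    refine HasDerivAt.congr_deriv ((((hasDerivAt_id t).pow 2).const_mul (C ^ 2)).add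
      ((hasDerivAt_id t).const_mul a) |>.add_const 1) ?_
    simp only [id, Nat.cast_ofNat]
    ring
  have hf := (((hasDerivAt_const t (1 : ℝ)).div (hasDerivAt_id t) ht0).mul
    ((hquad C).div (hquad (4 * C)) hQ)).deriv
  have hg := (((hlin.add_const 1).const_mul (3 * C)).div
    ((hquad (4 * C)).mul (hlin.sub_const 1)) (mul_ne_zero hQ hs')).deriv
  change deriv f t = _ at hf
  change deriv g t = _ at hg
  rw [hf, hg]
  simp only [f, g, id, Pi.mul_apply, Pi.div_apply]
  generalize hq : C ^ 2 * t ^ 2 + 4 * C * t + 1 = Q at hQ ⊢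
  generalize hr : C * t - 1 = R at hs' ⊢
  constructor <;> field_simp <;> subst hq hr <;> ring
end

section
/- Let c be a real number. Define f(t) = 1/(2t) and g(t) = tan(−(1/2)·ln t + c)/(2t). Then for every t > 0 with cos(−(1/2)·ln t + c) ≠ 0, the functions f and g satisfy t·f'(t) + f(t) + g(t) − 2·f(t)·g(t)·t = 0 and t·g'(t) + g(t) + f(t) − t·(f(t)² − g(t)²) = 0. -/
/-- The family `f(t) = 1/(2t)`, `g(t) = tan(−(1/2)ln t + c)/(2t)` solves the
Kapustin–Witten ODEs wherever the tangent is defined. -/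
theorem stmt_7 (c : ℝ) :
    let f : ℝ → ℝ := fun t => 1 / (2 * t)
    let g : ℝ → ℝ := fun t => Real.tan (-(1 / 2) * Real.log t + c) / (2 * t)
    ∀ t : ℝ, 0 < t → Real.cos (-(1 / 2) * Real.log t + c) ≠ 0 →
      (t * deriv f t + f t + g t - 2 * f t * g t * t = 0) ∧
      (t * deriv g t + g t + f t - t * (f t ^ 2 - g t ^ 2) = 0) := by
  intro f g t ht hcos
  have ht0 : t ≠ 0 := ht.ne'
  have h2t : HasDerivAt (fun s : ℝ => 2 * s) 2 t := by
    simpa using (hasDerivAt_id t).const_mul (2 : ℝ)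
  have hf : HasDerivAt f ((0 * (2 * t) - 1 * 2) / (2 * t) ^ 2) t :=
    (hasDerivAt_const t (1 : ℝ)).div h2t (by positivity)
  have harg : HasDerivAt (fun s : ℝ => -(1 / 2) * Real.log s + c) (-(1 / 2) * t⁻¹) t :=
    ((Real.hasDerivAt_log ht0).const_mul _).add_const c
  have hg := ((Real.hasDerivAt_tan hcos).comp t harg).div h2t (by positivity)
  have hsec : 1 / Real.cos (-(1 / 2) * Real.log t + c) ^ 2
      = 1 + Real.tan (-(1 / 2) * Real.log t + c) ^ 2 := by
    rw [one_div, ← Real.inv_one_add_tan_sq hcos, inv_inv]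
  rw [hsec] at hg
  have hg' : deriv g t = _ := hg.deriv
  rw [hf.deriv, hg']
  simp only [f, g, Function.comp_apply]
  generalize Real.tan (-(1 / 2) * Real.log t + c) = T
  constructor <;> field_simp <;> ring
end

section
/- Let I ⊆ ℝ be an open interval and W : I → ℝ a differentiable function with W(s) > 0 for all s ∈ I, satisfying W'(s) = (1/√3)·√(W(s))·√(W(s)+1)·(2·W(s) − 1) for all s ∈ I. Define H(s) := (1 + 4·W(s))/(2·√3·√(W(s)² + W(s))). Then H is differentiable on I and H'(s) = H(s)² − 1 for all s ∈ I. -/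
/-- The substitution `H = (1+4W)/(2√3·√(W²+W))` transforms the reduced ODE
`W' = (1/√3)·√W·√(W+1)·(2W−1)` into `H' = H² − 1`. -/
theorem stmt_8 (a b : ℝ) (W : ℝ → ℝ)
    (hW : ∀ s ∈ Set.Ioo a b, DifferentiableAt ℝ W s)
    (hWpos : ∀ s ∈ Set.Ioo a b, 0 < W s)
    (hode : ∀ s ∈ Set.Ioo a b, deriv W s =
      (1 / Real.sqrt 3) * Real.sqrt (W s) * Real.sqrt (W s + 1) * (2 * W s - 1)) :
    let H : ℝ → ℝ := fun s => (1 + 4 * W s) / (2 * Real.sqrt 3 * Real.sqrt (W s ^ 2 + W s))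
    ∀ s ∈ Set.Ioo a b, DifferentiableAt ℝ H s ∧ deriv H s = H s ^ 2 - 1 := by
  intro H s hs
  have hw := hWpos s hs
  have hQ : 0 < W s ^ 2 + W s := by positivity
  have h3 : Real.sqrt 3 ^ 2 = 3 := Real.sq_sqrt (by norm_num)
  have h3pos : 0 < Real.sqrt 3 := by positivity
  have hq : Real.sqrt (W s ^ 2 + W s) ^ 2 = W s ^ 2 + W s := Real.sq_sqrt hQ.le
  have hqpos : 0 < Real.sqrt (W s ^ 2 + W s) := Real.sqrt_pos.mpr hQ
  have hmul : Real.sqrt (W s) * Real.sqrt (W s + 1) = Real.sqrt (W s ^ 2 + W s) := by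
    rw [← Real.sqrt_mul hw.le]
    ring_nf
  have hWd : HasDerivAt W
      (1 / Real.sqrt 3 * Real.sqrt (W s ^ 2 + W s) * (2 * W s - 1)) s := by
    have h := (hW s hs).hasDerivAt
    rwa [hode s hs, mul_assoc (1 / Real.sqrt 3), hmul] at h
  have hH := ((hWd.const_mul 4).const_add 1).div
    ((((hWd.fun_pow 2).fun_add hWd).sqrt hQ.ne').const_mul (2 * Real.sqrt 3))
    (by positivity)
  refine ⟨hH.differentiableAt, hH.deriv.trans ?_⟩
  simp only [H]
  generalize Real.sqrt (W s ^ 2 + W s) = q at *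
  generalize Real.sqrt 3 = r at *
  generalize W s = w at *
  have hr : r ≠ 0 := h3pos.ne'
  have hq0 : q ≠ 0 := hqpos.ne'
  have hH2 : ((1 + 4 * w) / (2 * r * q)) ^ 2 - 1 = (2 * w - 1) ^ 2 / (12 * q ^ 2) := by
    field_simp
    rw [h3, hq]
    ring
  rw [hH2]
  field_simp
  rw [h3, hq]
  push_cast
  ring
end

section
/- The function h : [0,∞) → ℝ defined by h(t) = 108·(2t⁴ + 2t³ + t² + 2t + 2)/(t² + 4t + 1)⁴ is strictly decreasing on [0,∞); in particular h(t) ≤ h(0) = 216 for all t ≥ 0. -/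
/-- The squared curvature norm `|F_A|²(t) = 108(2t⁴+2t³+t²+2t+2)/(t²+4t+1)⁴` is
strictly decreasing on `[0,∞)`; in particular it is bounded by its value `216` at `0`. -/
theorem stmt_12 :
    let h : ℝ → ℝ := fun t =>
      108 * (2 * t ^ 4 + 2 * t ^ 3 + t ^ 2 + 2 * t + 2) / (t ^ 2 + 4 * t + 1) ^ 4
    StrictAntiOn h (Set.Ici 0) ∧ h 0 = 216 ∧ ∀ t : ℝ, 0 ≤ t → h t ≤ 216 := by
  intro h
  have deriv_h (t : ℝ) (ht : 0 ≤ t) : HasDerivAt h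
      (-(108 * (8 * t ^ 5 + 10 * t ^ 4 + 6 * t ^ 3 + 16 * t ^ 2 + 38 * t + 30)) /
        (t ^ 2 + 4 * t + 1) ^ 5) t := by
    have hq : t ^ 2 + 4 * t + 1 ≠ 0 := by positivity
    have hid := hasDerivAt_id' t
    have hnum := ((((((hid.pow 4).const_mul 2).add ((hid.pow 3).const_mul 2)).add
      (hid.pow 2)).add (hid.const_mul 2)).add_const 2).const_mul 108
    have hden := (((hid.pow 2).add (hid.const_mul 4)).add_const 1).pow 4
    refine (hnum.div hden (pow_ne_zero 4 hq)).congr_deriv ?_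
    simp only [Pi.add_apply, Pi.pow_apply]
    field_simp
    push_cast
    ring
  have anti : StrictAntiOn h (Set.Ici 0) := by
    refine strictAntiOn_of_deriv_neg (convex_Ici 0)
      (fun t ht => (deriv_h t ht).continuousAt.continuousWithinAt) fun t ht => ?_
    rw [interior_Ici, Set.mem_Ioi] at ht
    rw [(deriv_h t ht.le).deriv]
    exact div_neg_of_neg_of_pos (neg_neg_of_pos (by positivity)) (by positivity)
  have h_zero : h 0 = 216 := by norm_num [h]
  exact ⟨anti, h_zero, fun t ht =>
    h_zero ▸ anti.antitoneOn Set.self_mem_Ici (Set.mem_Ici.2 ht) ht⟩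
end

section
/- The function h : ℝ → ℝ defined by h(t) = 432·(2t⁸ + 6t⁷ + 5t⁶ + 2t⁵ + 6t⁴ + 2t³ + 5t² + 6t + 2)/((t² + 4t + 1)²·(t − 1)²·(t³ + 3t² − 3t + 1)²) is not Lebesgue integrable on the interval (0, 2). -/
/-- The squared norm `|d_Aφ|²` as a rational function of `t` is not Lebesgue
integrable on `(0, 2)` (non-integrability across the pole at `t = 1`). -/
theorem stmt_14 :
    let h : ℝ → ℝ := fun t =>
      432 * (2 * t ^ 8 + 6 * t ^ 7 + 5 * t ^ 6 + 2 * t ^ 5 + 6 * t ^ 4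
          + 2 * t ^ 3 + 5 * t ^ 2 + 6 * t + 2) /
        ((t ^ 2 + 4 * t + 1) ^ 2 * (t - 1) ^ 2 * (t ^ 3 + 3 * t ^ 2 - 3 * t + 1) ^ 2)
    ¬ MeasureTheory.IntegrableOn h (Set.Ioo 0 2) MeasureTheory.volume := by
  intro h hint
  refine not_intervalIntegrable_of_sub_inv_isBigO_punctured (f := h) (a := 0) (b := 2) (c := 1)
    ?_ (by norm_num) (by rw [Set.uIcc_of_le] <;> norm_num)
    ((intervalIntegrable_iff_integrableOn_Ioo_of_le (by norm_num)).2 hint)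
  refine Asymptotics.IsBigO.of_bound 50 ?_
  filter_upwards [self_mem_nhdsWithin,
    mem_nhdsWithin_of_mem_nhds (Ioo_mem_nhds (zero_lt_one' ℝ) one_lt_two)] with t ht1 ⟨h0, h2⟩
  have hd : 0 < |t - 1| := abs_pos.2 (sub_ne_zero.2 ht1)
  have hd1 : |t - 1| ≤ 1 := abs_le.2 ⟨by linarith, by linarith⟩
  have hq : t ^ 2 + 4 * t + 1 ≤ 13 := by nlinarith
  have hc0 : 0 < t ^ 3 + 3 * t ^ 2 - 3 * t + 1 := by
    nlinarith [pow_pos h0 3, sq_nonneg (2 * t - 1)]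
  have hc : t ^ 3 + 3 * t ^ 2 - 3 * t + 1 ≤ 15 := by
    nlinarith [mul_pos h0 (sub_pos.2 h2), mul_pos (mul_pos h0 h0) (sub_pos.2 h2)]
  have hnum : 2 ≤ 2 * t ^ 8 + 6 * t ^ 7 + 5 * t ^ 6 + 2 * t ^ 5 + 6 * t ^ 4
      + 2 * t ^ 3 + 5 * t ^ 2 + 6 * t + 2 := le_add_of_nonneg_left (by positivity)
  rw [norm_inv, Real.norm_eq_abs, Real.norm_eq_abs]
  refine le_trans ?_ (mul_le_mul_of_nonneg_left (le_abs_self (h t)) (by norm_num))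
  calc |t - 1|⁻¹ ≤ 50 * (432 * 2 / (13 ^ 2 * |t - 1| ^ 2 * 15 ^ 2)) := by
        rw [inv_eq_one_div, mul_div_assoc', div_le_div_iff₀ hd (by positivity)]
        nlinarith [mul_le_mul_of_nonneg_left hd1 hd.le]
    _ ≤ 50 * h t := by
        dsimp only [h]
        rw [← sq_abs (t - 1)]
        gcongr
end

section
/- Define f : (0,∞) → ℝ by f(t) = 3/(t² + 4t + 1) for 0 < t ≤ 1 and f(t) = (t² + t + 1)/(t·(t² + 4t + 1)) for t ≥ 1. Then f is continuously differentiable on (0,∞) (in particular, the two pieces agree to first order at t = 1, where f(1) = 1/2 and f'(1) = −1/2). -/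
theorem hasDerivAt_max_zero_sq (x : ℝ) :
    HasDerivAt (fun y : ℝ => max y 0 ^ 2) (2 * max x 0) x := by
  rcases lt_trichotomy x 0 with hx | rfl | hx
  · rw [max_eq_right hx.le, mul_zero]
    refine (hasDerivAt_const x (0 : ℝ)).congr_of_eventuallyEq ?_
    filter_upwards [eventually_lt_nhds hx] with y hy
    simp [max_eq_right hy.le]
  · have hl : HasDerivWithinAt (fun y : ℝ => max y 0 ^ 2) (2 * max 0 0) (Set.Iic 0) 0 := by
      rw [max_self, mul_zero]
      refine (hasDerivWithinAt_const 0 _ (0 : ℝ)).congr (fun y hy => ?_) (by simp)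
      simp [max_eq_right (Set.mem_Iic.mp hy)]
    have hr : HasDerivWithinAt (fun y : ℝ => max y 0 ^ 2) (2 * max 0 0) (Set.Ici 0) 0 := by
      have h : HasDerivAt (fun y : ℝ => y ^ 2) (2 * max 0 0) 0 := by
        simpa using hasDerivAt_pow 2 (0 : ℝ)
      refine h.hasDerivWithinAt.congr (fun y hy => ?_) (by simp)
      simp [max_eq_left (Set.mem_Ici.mp hy)]
    simpa [Set.Iic_union_Ici, hasDerivWithinAt_univ] using hl.union hr
  · rw [max_eq_left hx.le]
    have h : HasDerivAt (fun y : ℝ => y ^ 2) (2 * x) x := by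
      simpa using hasDerivAt_pow 2 x
    refine h.congr_of_eventuallyEq ?_
    filter_upwards [eventually_gt_nhds hx] with y hy
    simp [max_eq_left hy.le]

theorem contDiff_max_zero_sq : ContDiff ℝ 1 (fun y : ℝ => max y 0 ^ 2) := by
  refine contDiff_one_iff_deriv.mpr
    ⟨fun x => (hasDerivAt_max_zero_sq x).differentiableAt, ?_⟩
  rw [funext fun x => (hasDerivAt_max_zero_sq x).deriv]
  fun_prop

/-- The outer piece exceeds the inner one by `(t - 1)² / (t (t² + 4t + 1))`. -/
theorem piecewise_profile_eq {t : ℝ} (ht : 0 < t) :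
    (if t ≤ 1 then 3 / (t ^ 2 + 4 * t + 1)
      else (t ^ 2 + t + 1) / (t * (t ^ 2 + 4 * t + 1))) =
    3 / (t ^ 2 + 4 * t + 1) + max (t - 1) 0 ^ 2 / (t * (t ^ 2 + 4 * t + 1)) := by
  have hD : t ^ 2 + 4 * t + 1 ≠ 0 := by positivity
  split_ifs with h
  · simp [max_eq_right (sub_nonpos.mpr h)]
  · rw [max_eq_left (by linarith)]
    field_simp
    ring

/-- The piecewise radial profile of the instanton-number-1 solution is `C¹` on
`(0,∞)`, with `f(1) = 1/2` and `f′(1) = −1/2`. -/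
theorem stmt_15 :
    let f : ℝ → ℝ := fun t =>
      if t ≤ 1 then 3 / (t ^ 2 + 4 * t + 1)
      else (t ^ 2 + t + 1) / (t * (t ^ 2 + 4 * t + 1))
    ContDiffOn ℝ 1 f (Set.Ioi 0) ∧ f 1 = 1 / 2 ∧ deriv f 1 = -(1 / 2) := by
  intro f
  have hf : ContDiffOn ℝ 1 f (Set.Ioi 0) := by
    refine ContDiffOn.congr ?_ fun t ht => piecewise_profile_eq (Set.mem_Ioi.mp ht)
    have hD : ContDiffOn ℝ 1 (fun t : ℝ => t ^ 2 + 4 * t + 1) (Set.Ioi 0) := by fun_prop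
    refine (contDiffOn_const.div hD fun t ht => ?_).add
      ((contDiff_max_zero_sq.comp (contDiff_id.sub contDiff_const)).contDiffOn.div
        (contDiffOn_id.mul hD) fun t ht => ?_)
    all_goals
      have := Set.mem_Ioi.mp ht
      positivity
  refine ⟨hf, by norm_num [f], ?_⟩
  have hd : DifferentiableAt ℝ f 1 :=
    (hf.differentiableOn one_ne_zero).differentiableAt (Ioi_mem_nhds one_pos)
  have hD : HasDerivAt (fun t : ℝ => t ^ 2 + 4 * t + 1) 6 1 := by
    have h := ((hasDerivAt_pow 2 (1 : ℝ)).add ((hasDerivAt_id (1 : ℝ)).const_mul 4)).add_const 1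
    exact h.congr_deriv (by norm_num)
  have hl : HasDerivWithinAt f (-(1 / 2)) (Set.Iic 1) 1 := by
    have h := (hasDerivAt_const (1 : ℝ) (3 : ℝ)).div hD (by norm_num)
    norm_num at h
    refine HasDerivWithinAt.congr (by simpa using h.hasDerivWithinAt) (fun t ht => ?_) ?_
    · exact if_pos ht
    · exact if_pos le_rfl
  exact (uniqueDiffWithinAt_Iic (1 : ℝ)).eq_deriv _ hd.hasDerivAt.hasDerivWithinAt hl
end

section
/- Let λ be a nonzero real number and ε > 0. Suppose f, g : [0, ε) → ℝ are continuous, differentiable on (0, ε), with t·f'(t) → 0 as t → 0⁺, and satisfy for all t ∈ (0, ε): (λ+λ⁻¹)·t·f'(t) + 2λ·f(t) − (λ−λ⁻¹)·t·(f(t)² − g(t)²) − 2·g(t) + 4·f(t)·g(t)·t = 0. Then λ·f(0) = g(0). -/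
open Filter

/-- Any solution of the (degenerate at `t = 0`) topological twisted ODEs that is
well-behaved near `t = 0` satisfies the constraint `λ·f(0) = g(0)`. -/
theorem stmt_18 (l : ℝ) (hl : l ≠ 0) (ε : ℝ) (hε : 0 < ε) (f g : ℝ → ℝ)
    (hfc : ContinuousOn f (Set.Ico 0 ε)) (hgc : ContinuousOn g (Set.Ico 0 ε))
    (hfd : ∀ t ∈ Set.Ioo 0 ε, DifferentiableAt ℝ f t)
    (hlim : Tendsto (fun t => t * deriv f t) (nhdsWithin 0 (Set.Ioi 0)) (nhds 0))
    (h1 : ∀ t ∈ Set.Ioo 0 ε,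
      (l + l⁻¹) * t * deriv f t + 2 * l * f t
        - (l - l⁻¹) * t * (f t ^ 2 - g t ^ 2) - 2 * g t + 4 * f t * g t * t = 0) :
    l * f 0 = g 0 := by
  have tendsto_right : ∀ u : ℝ → ℝ, ContinuousOn u (Set.Ico 0 ε) →
      Tendsto u (nhdsWithin 0 (Set.Ioi 0)) (nhds (u 0)) := fun u hu => by
    rw [← nhdsWithin_Ioo_eq_nhdsGT hε]
    exact (hu 0 ⟨le_rfl, hε⟩).mono_left (nhdsWithin_mono 0 Set.Ioo_subset_Ico_self)
  have hf := tendsto_right f hfc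
  have hg := tendsto_right g hgc
  have ht : Tendsto (fun t : ℝ => t) (nhdsWithin 0 (Set.Ioi 0)) (nhds 0) :=
    tendsto_nhdsWithin_of_tendsto_nhds tendsto_id
  have hlhs := (((((hlim.const_mul (l + l⁻¹)).add (hf.const_mul (2 * l))).sub
    ((ht.const_mul (l - l⁻¹)).mul ((hf.pow 2).sub (hg.pow 2)))).sub (hg.const_mul 2)).add
    (((hf.const_mul 4).mul hg).mul ht))
  have hzero := hlhs.congr' (f₂ := fun _ => (0 : ℝ)) (by
    filter_upwards [Ioo_mem_nhdsGT hε] with t htε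
    linear_combination h1 t htε)
  have heq := tendsto_nhds_unique hzero tendsto_const_nhds
  linear_combination heq / 2
end
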